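/- Suppose q > 1 belongs to the closure of the set U of univoque numbers and q is not an integer. Then U_q is not a Cantor set, but the closure of U_q in ℝ is a Cantor set, i.e., a nonempty closed subset of ℝ having empty interior and no isolated points. -/

import Mathlib

open Classical

noncomputable section

/-- The largest digit in base `q`: `α₁ = ⌈q⌉ - 1`. -/
def alphaOne (q : ℝ) : ℕ := (⌈q⌉ - 1).toNat

/-- `c` (0-indexed: `c i` is the digit `c_{i+1}` of the paper) is an expansion of `x`
in base `q`: all digits lie in `{0, …, α₁}` and `x = ∑_{i≥1} c_i q^{-i}`. -/
def IsExpansionOf (q x : ℝ) (c : ℕ → ℕ) : Prop :=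
  (∀ i, c i ≤ alphaOne q) ∧ x = ∑' i, (c i : ℝ) / q ^ (i + 1)

/-- A sequence is called infinite if it has infinitely many nonzero terms. -/
def InfiniteSeq (c : ℕ → ℕ) : Prop := {i | c i ≠ 0}.Infinite

/-- Strict lexicographic order on sequences. -/
def LexLt (a b : ℕ → ℕ) : Prop := ∃ n, (∀ i, i < n → a i = b i) ∧ a n < b n

/-- Lexicographic order `≤` on sequences. -/
def LexLe (a b : ℕ → ℕ) : Prop := LexLt a b ∨ a = b

/-- `b` is the greedy (lexicographically largest) expansion of `x` in base `q`. -/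
def IsGreedyOf (q x : ℝ) (b : ℕ → ℕ) : Prop :=
  IsExpansionOf q x b ∧ ∀ c, IsExpansionOf q x c → LexLe c b

/-- `a` is the quasi-greedy (lexicographically largest infinite) expansion of `x`
in base `q`. -/
def IsQuasiGreedyOf (q x : ℝ) (a : ℕ → ℕ) : Prop :=
  IsExpansionOf q x a ∧ InfiniteSeq a ∧
    ∀ c, IsExpansionOf q x c → InfiniteSeq c → LexLe c a

/-- The quasi-greedy expansion of `x` in base `q`; by convention it is the zero
sequence whenever no infinite expansion exists (in particular for `x = 0`). -/
def quasiGreedy (q x : ℝ) : ℕ → ℕ :=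
  if h : ∃ a, IsQuasiGreedyOf q x a then h.choose else fun _ => 0

/-- The greedy expansion of `x` in base `q` (zero sequence if `x` has no expansion). -/
def greedy (q x : ℝ) : ℕ → ℕ :=
  if h : ∃ b, IsGreedyOf q x b then h.choose else fun _ => 0

/-- The interval `J_q = [0, α₁/(q-1)]`. -/
def Jq (q : ℝ) : Set ℝ := Set.Icc 0 ((alphaOne q : ℝ) / (q - 1))

/-- `U_q`: the set of real numbers having exactly one expansion in base `q`. -/
def Uq (q : ℝ) : Set ℝ := {x | ∃! c, IsExpansionOf q x c}

/-- `U_q'`: the set of univoque sequences in base `q`. -/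
def UqSeq (q : ℝ) : Set (ℕ → ℕ) := {c | ∃ x ∈ Uq q, IsExpansionOf q x c}

/-- `U`: the set of univoque numbers. -/
def USet : Set ℝ := {q | 1 < q ∧ ∃! c, IsExpansionOf q 1 c}

/-- `V_q`: the set of `x ∈ J_q` such that for every `n ≥ 1` with `a_n(x) > 0` the
conjugated shifted quasi-greedy expansion is lexicographically at most `(α_i)`. -/
def Vq (q : ℝ) : Set ℝ :=
  {x | x ∈ Jq q ∧ ∀ n, 0 < quasiGreedy q x n →
    LexLe (fun i => alphaOne q - quasiGreedy q x (n + 1 + i)) (quasiGreedy q 1)}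

/-- `V`: the set of `q > 1` whose quasi-greedy expansion `(α_i)` of `1` satisfies
`(α₁ - α_{k+i})_{i≥1} ≤ (α_i)_{i≥1}` lexicographically for all `k ≥ 1`. -/
def VSet : Set ℝ :=
  {q | 1 < q ∧ ∀ k, LexLe (fun i => alphaOne q - quasiGreedy q 1 (k + 1 + i)) (quasiGreedy q 1)}

/-- A Cantor set: a nonempty closed subset of `ℝ` with empty interior and no
isolated points. -/
def IsCantorSet (S : Set ℝ) : Prop :=
  S.Nonempty ∧ IsClosed S ∧ interior S = ∅ ∧ ∀ x ∈ S, x ∈ closure (S \ {x})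

/-- The value `∑ c_i q^{-i}` of a digit sequence in base `q`. -/
def val (q : ℝ) (c : ℕ → ℕ) : ℝ := ∑' i, (c i : ℝ) / q ^ (i + 1)

/-- The sequence `c` with its first `n` terms removed. -/
def shift (c : ℕ → ℕ) (n : ℕ) : ℕ → ℕ := fun i => c (n + i)

/-- The conjugate of a digit sequence over the alphabet `{0, …, M}`. -/
def conj (M : ℕ) (c : ℕ → ℕ) : ℕ → ℕ := fun i => M - c i

/-- The first `n` terms of `c` followed by `d`. -/
def splice (c : ℕ → ℕ) (n : ℕ) (d : ℕ → ℕ) : ℕ → ℕ := fun i => if i < n then c i else d (i - n)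

/-- `q` lies strictly between the positive integer `M` and `M + 1`. -/
structure NonIntBase (q : ℝ) (M : ℕ) : Prop where
  pos : 0 < M
  lt : (M : ℝ) < q
  lt_succ : q < M + 1

theorem shift_shift (c : ℕ → ℕ) (m n : ℕ) : shift (shift c m) n = shift c (m + n) := by
  funext i; simp [shift, add_assoc]

@[simp] theorem shift_zero (c : ℕ → ℕ) : shift c 0 = c := by
  funext i; simp [shift]

theorem shift_conj (M : ℕ) (c : ℕ → ℕ) (n : ℕ) : shift (conj M c) n = conj M (shift c n) := rfl

theorem shift_le {M : ℕ} {c : ℕ → ℕ} (hc : ∀ i, c i ≤ M) (n i : ℕ) : shift c n i ≤ M := hc _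

theorem conj_conj {M : ℕ} {c : ℕ → ℕ} (hc : ∀ i, c i ≤ M) : conj M (conj M c) = c := by
  funext i; have := hc i; simp only [conj]; omega

theorem conj_le (M : ℕ) (c : ℕ → ℕ) (i : ℕ) : conj M c i ≤ M := Nat.sub_le _ _

theorem shift_splice (c d : ℕ → ℕ) (n j : ℕ) : shift (splice c n d) (n + j) = shift d j := by
  funext i
  simp only [shift, splice]
  rw [if_neg (by omega)]
  congr 1; omega

theorem shift_splice_self (c d : ℕ → ℕ) (n : ℕ) : shift (splice c n d) n = d := by
  simpa using shift_splice c d n 0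

theorem splice_le {M n : ℕ} {c d : ℕ → ℕ} (hc : ∀ i, c i ≤ M) (hd : ∀ i, d i ≤ M) (i : ℕ) :
    splice c n d i ≤ M := by
  unfold splice; split_ifs
  · exact hc i
  · exact hd _

namespace NonIntBase

variable {q : ℝ} {M : ℕ}

theorem one_lt (h : NonIntBase q M) : 1 < q := by
  have h1 : (1 : ℝ) ≤ M := by exact_mod_cast h.pos
  exact h1.trans_lt h.lt

theorem one_lt_top (h : NonIntBase q M) : 1 < (M : ℝ) / (q - 1) := by
  rw [lt_div_iff₀ (by linarith [h.one_lt])]; linarith [h.lt_succ]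

theorem top_eq (h : NonIntBase q M) : q * ((M : ℝ) / (q - 1)) = M / (q - 1) + M := by
  have : q - 1 ≠ 0 := by linarith [h.one_lt]
  field_simp; ring

theorem alphaOne_eq (h : NonIntBase q M) : alphaOne q = M := by
  have : ⌈q⌉ = (M : ℤ) + 1 := by
    rw [Int.ceil_eq_iff]; push_cast; exact ⟨by linarith [h.lt], h.lt_succ.le⟩
  simp [alphaOne, this]

end NonIntBase

theorem hasSum_of_orbit {q : ℝ} (hq : 1 < q) {c : ℕ → ℕ} {y : ℕ → ℝ} {B : ℝ}
    (hB : ∀ n, |y n| ≤ B) (hy : ∀ n, y (n + 1) = q * y n - c n) :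
    HasSum (fun i => (c i : ℝ) / q ^ (i + 1)) (y 0) := by
  have hq0 : 0 < q := by linarith
  have hsum : ∀ N, ∑ i ∈ Finset.range N, (c i : ℝ) / q ^ (i + 1) = y 0 - y N / q ^ N := by
    intro N
    induction N with
    | zero => simp
    | succ N ih =>
      rw [Finset.sum_range_succ, ih, hy]
      field_simp
      ring
  rw [hasSum_iff_tendsto_nat_of_nonneg (fun i => by positivity)]
  simp only [hsum]
  have hz : Filter.Tendsto (fun N => y N / q ^ N) Filter.atTop (nhds 0) := by
    apply squeeze_zero_norm (a := fun N => B * (1 / q) ^ N)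
    · intro N
      rw [norm_div, norm_pow, Real.norm_of_nonneg hq0.le, Real.norm_eq_abs, div_pow, one_pow,
        mul_one_div]
      exact div_le_div_of_nonneg_right (hB N) (by positivity)
    · simpa using (tendsto_pow_atTop_nhds_zero_of_lt_one (by positivity)
        ((div_lt_one hq0).2 hq)).const_mul B
  simpa using hz.const_sub (y 0)

theorem val_shift_of_orbit {q : ℝ} (hq : 1 < q) {c : ℕ → ℕ} {y : ℕ → ℝ} {B : ℝ}
    (hB : ∀ n, |y n| ≤ B) (hy : ∀ n, y (n + 1) = q * y n - c n) (n : ℕ) :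
    val q (shift c n) = y n := by
  have := hasSum_of_orbit hq (c := shift c n) (y := fun i => y (n + i)) (fun i => hB _)
    (fun i => hy (n + i))
  exact this.tsum_eq

section Values

variable {q : ℝ} {M : ℕ} {c d : ℕ → ℕ}

theorem hasSum_const_digit (h : NonIntBase q M) :
    HasSum (fun i : ℕ => (M : ℝ) / q ^ (i + 1)) (M / (q - 1)) :=
  hasSum_of_orbit h.one_lt (c := fun _ => M) (y := fun _ => (M : ℝ) / (q - 1))
    (fun _ => le_rfl) (fun _ => by simp only [h.top_eq]; ring)

theorem summable_digits (h : NonIntBase q M) (hc : ∀ i, c i ≤ M) :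
    Summable (fun i => (c i : ℝ) / q ^ (i + 1)) := by
  have hq0 : 0 < q := by linarith [h.one_lt]
  refine Summable.of_nonneg_of_le (fun i => by positivity) (fun i => ?_)
    (hasSum_const_digit h).summable
  have : (c i : ℝ) ≤ M := by exact_mod_cast hc i
  gcongr

theorem val_nonneg (h : NonIntBase q M) (c : ℕ → ℕ) : 0 ≤ val q c := by
  have hq0 : 0 < q := by linarith [h.one_lt]
  exact tsum_nonneg (fun i => by positivity)

theorem val_conj (h : NonIntBase q M) (hc : ∀ i, c i ≤ M) :
    val q (conj M c) = M / (q - 1) - val q c := by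
  have h1 := (hasSum_const_digit h).sub (summable_digits h hc).hasSum
  unfold val
  rw [← h1.tsum_eq]
  refine tsum_congr fun i => ?_
  rw [conj, Nat.cast_sub (hc i), sub_div]

theorem val_le (h : NonIntBase q M) (hc : ∀ i, c i ≤ M) : val q c ≤ M / (q - 1) := by
  have := val_nonneg h (conj M c)
  rw [val_conj h hc] at this
  linarith

theorem val_shift_succ (h : NonIntBase q M) (hc : ∀ i, c i ≤ M) (n : ℕ) :
    val q (shift c (n + 1)) = q * val q (shift c n) - c n := by
  have hq0 : 0 < q := by linarith [h.one_lt]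
  have hs := summable_digits h (c := shift c n) (fun i => hc _)
  have h1 : val q (shift c n) = (c n : ℝ) / q + val q (shift c (n + 1)) / q := by
    unfold val
    rw [hs.tsum_eq_zero_add, ← tsum_div_const]
    congr 1
    · simp [shift]
    · congr 1; funext i
      simp only [shift]
      rw [show n + (i + 1) = n + 1 + i by ring, pow_succ q (i + 1), div_div]
  rw [h1]; field_simp; ring

theorem val_sub_val (h : NonIntBase q M) (hc : ∀ i, c i ≤ M) (hd : ∀ i, d i ≤ M) (n : ℕ)
    (hcd : ∀ i < n, c i = d i) :
    val q c - val q d = (val q (shift c n) - val q (shift d n)) / q ^ n := by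
  have hq0 : 0 < q := by linarith [h.one_lt]
  induction n with
  | zero => simp
  | succ n ih =>
    rw [ih (fun i hi => hcd i (by omega)), val_shift_succ h hc, val_shift_succ h hd,
      hcd n (by omega)]
    field_simp
    ring

theorem abs_val_sub_val_le (h : NonIntBase q M) (hc : ∀ i, c i ≤ M) (hd : ∀ i, d i ≤ M) (n : ℕ)
    (hcd : ∀ i < n, c i = d i) :
    |val q c - val q d| ≤ (M / (q - 1)) / q ^ n := by
  have hq0 : 0 < q := by linarith [h.one_lt]
  rw [val_sub_val h hc hd n hcd, abs_div, abs_of_pos (pow_pos hq0 n)]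
  refine div_le_div_of_nonneg_right ?_ (by positivity)
  have h1 := val_nonneg h (shift c n)
  have h2 := val_nonneg h (shift d n)
  have h3 := val_le h (c := shift c n) (fun i => hc _)
  have h4 := val_le h (c := shift d n) (fun i => hd _)
  rw [abs_le]; constructor <;> linarith

theorem exists_val_eq (h : NonIntBase q M) {x : ℝ} (hx0 : 0 ≤ x) (hx1 : x ≤ M / (q - 1)) :
    ∃ c : ℕ → ℕ, (∀ i, c i ≤ M) ∧ val q c = x := by
  have hq0 : 0 < q := by linarith [h.one_lt]
  let y : ℕ → ℝ := fun n => Nat.rec x (fun _ z => q * z - (min M ⌊q * z⌋₊ : ℕ)) n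
  have hy : ∀ n, y (n + 1) = q * y n - (min M ⌊q * y n⌋₊ : ℕ) := fun n => rfl
  have hb : ∀ n, 0 ≤ y n ∧ y n ≤ M / (q - 1) := by
    intro n
    induction n with
    | zero => exact ⟨hx0, hx1⟩
    | succ n ih =>
      have h0 : 0 ≤ q * y n := mul_nonneg hq0.le ih.1
      have h1 : q * y n ≤ M / (q - 1) + M := by
        rw [← h.top_eq]; exact mul_le_mul_of_nonneg_left ih.2 hq0.le
      have hf := Nat.floor_le h0
      have hl := Nat.lt_floor_add_one (q * y n)
      rw [hy]
      rcases le_total M ⌊q * y n⌋₊ with hm | hm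
      · rw [min_eq_left hm]
        have : (M : ℝ) ≤ ⌊q * y n⌋₊ := by exact_mod_cast hm
        constructor <;> linarith
      · rw [min_eq_right hm]
        have := h.one_lt_top
        constructor <;> linarith
  refine ⟨fun n => min M ⌊q * y n⌋₊, fun i => min_le_left _ _, ?_⟩
  have := val_shift_of_orbit h.one_lt (c := fun n => min M ⌊q * y n⌋₊) (y := y)
    (B := M / (q - 1)) (fun n => by rw [abs_of_nonneg (hb n).1]; exact (hb n).2) hy 0
  rw [shift_zero] at this
  exact this

end Values

/-- `c` is the only sequence over `{0, …, M}` with its value in base `q`. -/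
def IsUnivoque (q : ℝ) (M : ℕ) (c : ℕ → ℕ) : Prop :=
  (∀ i, c i ≤ M) ∧ ∀ d : ℕ → ℕ, (∀ i, d i ≤ M) → val q d = val q c → d = c

section Univoque

variable {q : ℝ} {M : ℕ} {c : ℕ → ℕ}

theorem NonIntBase.isExpansionOf_iff (h : NonIntBase q M) {x : ℝ} :
    IsExpansionOf q x c ↔ (∀ i, c i ≤ M) ∧ x = val q c := by
  rw [IsExpansionOf, h.alphaOne_eq]; rfl

theorem existsUnique_expansion_iff (h : NonIntBase q M) {x : ℝ} :
    (∃! c, IsExpansionOf q x c) ↔ ∃ c, IsUnivoque q M c ∧ val q c = x := by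
  simp only [ExistsUnique, h.isExpansionOf_iff]
  constructor
  · rintro ⟨c, ⟨hc, rfl⟩, hu⟩
    exact ⟨c, ⟨hc, fun d hd he => hu d ⟨hd, he.symm⟩⟩, rfl⟩
  · rintro ⟨c, ⟨hc, hu⟩, rfl⟩
    exact ⟨c, ⟨hc, rfl⟩, fun d hd => hu d hd.1 hd.2.symm⟩

theorem IsUnivoque.conj (h : NonIntBase q M) (hc : IsUnivoque q M c) :
    IsUnivoque q M (conj M c) := by
  refine ⟨conj_le M c, fun d hd he => ?_⟩
  rw [← hc.2 (_root_.conj M d) (conj_le M d) ?_, conj_conj hd]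
  rw [val_conj h hd, he, val_conj h hc.1]; ring

theorem IsUnivoque.val_shift_lt_one (h : NonIntBase q M) (hc : IsUnivoque q M c) {n : ℕ}
    (hn : c n < M) : val q (shift c (n + 1)) < 1 := by
  by_contra! hv
  obtain ⟨e, he, hev⟩ := exists_val_eq h (x := val q (shift c (n + 1)) - 1) (by linarith)
    (by linarith [val_le h (c := shift c (n + 1)) (fun i => hc.1 _)])
  let d : ℕ → ℕ := splice (Function.update c n (c n + 1)) (n + 1) e
  have hdn : d n = c n + 1 := by simp [d, splice]
  have hd : ∀ i, d i ≤ M := by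
    refine splice_le (fun i => ?_) he
    by_cases hi : i = n
    · subst hi; simpa using hn
    · simpa [hi] using hc.1 i
  have hds : shift d (n + 1) = e := shift_splice_self _ e (n + 1)
  have hag : ∀ i < n, d i = c i := by
    intro i hi
    simp [d, splice, hi.ne, show i < n + 1 by omega]
  have h1 := val_shift_succ h hd n
  have h2 := val_shift_succ h hc.1 n
  have hq0 : 0 < q := by linarith [h.one_lt]
  have h3 : val q (shift d n) = val q (shift c n) := by
    rw [hds, hdn, hev] at h1
    push_cast at h1
    have : q * val q (shift d n) = q * val q (shift c n) := by linarith
    exact mul_left_cancel₀ hq0.ne' this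
  have h4 := val_sub_val h hd hc.1 n hag
  rw [h3, sub_self, zero_div, sub_eq_zero] at h4
  have := congrFun (hc.2 d hd h4) n
  omega

theorem IsUnivoque.val_conj_shift_lt_one (h : NonIntBase q M) (hc : IsUnivoque q M c) {n : ℕ}
    (hn : 0 < c n) : val q (_root_.conj M (shift c (n + 1))) < 1 := by
  have := hc.1 n
  refine (hc.conj h).val_shift_lt_one h (n := n) ?_
  simp only [_root_.conj]; omega

theorem isUnivoque_of_val_lt (h : NonIntBase q M) (hc : ∀ i, c i ≤ M)
    (h1 : ∀ n, c n < M → val q (shift c (n + 1)) < 1)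
    (h2 : ∀ n, 0 < c n → val q (conj M (shift c (n + 1))) < 1) : IsUnivoque q M c := by
  have hq0 : 0 < q := by linarith [h.one_lt]
  refine ⟨hc, fun d hd he => ?_⟩
  funext n
  induction n using Nat.strong_induction_on with
  | _ n ih =>
    have hv := val_sub_val h hd hc n ih
    rw [he, sub_self, eq_comm, div_eq_zero_iff, or_iff_left (by positivity), sub_eq_zero] at hv
    have e1 := val_shift_succ h hd n
    have e2 := val_shift_succ h hc n
    rw [hv] at e1
    rcases lt_trichotomy (d n) (c n) with hlt | heq | hlt
    · exfalso
      have := h2 n (by omega)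
      rw [val_conj h (shift_le hc _)] at this
      have hle := val_le h (shift_le hd (n + 1))
      have : (d n : ℝ) + 1 ≤ c n := by exact_mod_cast hlt
      linarith
    · exact heq
    · exfalso
      have := h1 n (by have := hd n; omega)
      have hle := val_nonneg h (shift d (n + 1))
      have : (c n : ℝ) + 1 ≤ d n := by exact_mod_cast hlt
      linarith

end Univoque

/-- A sequence over `{0, …, M}` that starts with `M`, is lexicographically at least each of its
shifts, and is strictly greater than the conjugate of each of its shifts. -/
structure IsAdmissible (M : ℕ) (α : ℕ → ℕ) : Prop where
  pos : 1 ≤ M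
  le : ∀ i, α i ≤ M
  zero : α 0 = M
  shift_le : ∀ k n, (∀ i < n, α (k + i) = α i) → α (k + n) ≤ α n
  conj_lt : ∀ k, LexLt (conj M (shift α k)) α

/-- All shifts of `β`, and their conjugates, are lexicographically less than `α`. -/
def IsCore (M : ℕ) (α β : ℕ → ℕ) : Prop :=
  (∀ i, β i ≤ M) ∧ ∀ n, LexLt (shift β n) α ∧ LexLt (conj M (shift β n)) α

/-- The lexicographic form of univoqueness relative to `α`. -/
def IsLexUnivoque (M : ℕ) (α c : ℕ → ℕ) : Prop :=
  (∀ i, c i ≤ M) ∧ (∀ n, c n < M → LexLt (shift c (n + 1)) α) ∧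
    ∀ n, 0 < c n → LexLt (conj M (shift c (n + 1))) α

section Combinatorics

variable {M : ℕ} {α : ℕ → ℕ}

theorem IsAdmissible.exists_prefix (hα : IsAdmissible M α) (m₀ : ℕ) :
    ∃ m ≥ m₀, ∀ k < m, ∃ j, k + j < m ∧ (∀ i < j, M - α (k + i) = α i) ∧
      M - α (k + j) < α j := by
  suffices H : ∃ m ≥ m₀, ¬ ∃ k < m, ∀ i, k + i < m → M - α (k + i) = α i by
    obtain ⟨m, hm, hbad⟩ := H
    refine ⟨m, hm, fun k hk => ?_⟩
    obtain ⟨j, hj, hlt⟩ := hα.conj_lt k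
    refine ⟨j, ?_, hj, hlt⟩
    by_contra! hge
    exact hbad ⟨k, hk, fun i hi => hj i (by omega)⟩
  by_contra! H
  have hex := H m₀ le_rfl
  obtain ⟨hk, hmatch⟩ := Nat.find_spec hex
  have hmin := fun k' (hlt : k' < Nat.find hex) => Nat.find_min hex hlt
  generalize Nat.find hex = k at hk hmatch hmin
  obtain ⟨n, hn, hlt⟩ := hα.conj_lt k
  simp only [conj, shift] at hn hlt
  have hge : m₀ ≤ k + n := by
    by_contra! hc
    have := hmatch n hc
    omega
  obtain ⟨k', hk', hmatch'⟩ := H (k + n + 1) (by omega)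
  rcases lt_trichotomy k' k with h1 | h1 | h1
  · exact hmin k' h1 ⟨by omega, fun i hi => hmatch' i (by omega)⟩
  · subst h1
    have := hmatch' n (by omega)
    omega
  · obtain ⟨s, rfl⟩ := Nat.exists_eq_add_of_lt h1
    have hs := hα.shift_le (s + 1) (n - (s + 1)) (fun i hi => by
      have e1 := hn (s + 1 + i) (by omega)
      have e2 := hmatch' i (by omega)
      rw [← e1, ← e2]
      congr 2; omega)
    have e2 := hmatch' (n - (s + 1)) (by omega)
    rw [show s + 1 + (n - (s + 1)) = n by omega] at hs
    rw [show k + s + 1 + (n - (s + 1)) = k + n by omega] at e2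
    omega

theorem IsAdmissible.exists_core (hα : IsAdmissible M α) (L : ℕ) :
    ∃ β, IsCore M α β ∧ ∀ i < L, β i = α i := by
  obtain ⟨m, hm, hgood⟩ := hα.exists_prefix (L + 2)
  have hlast : 0 < α (m - 1) := by
    obtain ⟨j, hj, -, hlt⟩ := hgood (m - 1) (by omega)
    have : j = 0 := by omega
    subst this
    rw [hα.zero, add_zero] at hlt
    omega
  let g : ℕ → ℕ := fun j => if j = m - 1 then α j - 1 else α j
  have hg1 : ∀ j, j < m - 1 → g j = α j := fun j hj => if_neg (by omega)
  have hg2 : g (m - 1) = α (m - 1) - 1 := if_pos rfl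
  let β : ℕ → ℕ := fun n => g (n % m)
  have hβ1 : ∀ n i, n % m + i < m → β (n + i) = g (n % m + i) := by
    intro n i hi
    simp only [β]
    rw [← Nat.mod_add_mod, Nat.mod_eq_of_lt hi]
  have hβ2 : ∀ n i, i < m → β (n + (m - n % m + i)) = g i := by
    intro n i hi
    have := Nat.mod_lt n (show 0 < m by omega)
    simp only [β]
    rw [← Nat.mod_add_mod, show n % m + (m - n % m + i) = i + m by omega, Nat.add_mod_right,
      Nat.mod_eq_of_lt hi]
  refine ⟨β, ⟨fun i => ?_, fun n => ⟨?_, ?_⟩⟩, fun i hi => ?_⟩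
  · have := hα.le (i % m)
    simp only [β, g]
    split_ifs <;> omega
  · have hk := Nat.mod_lt n (show 0 < m by omega)
    by_cases P : ∃ i, n % m + i < m - 1 ∧ α (n % m + i) ≠ α i
    · obtain ⟨h1, h2⟩ := Nat.find_spec P
      have hmin := fun i (hlt : i < Nat.find P) => Nat.find_min P hlt
      generalize Nat.find P = i at h1 h2 hmin
      have heq : ∀ j < i, α (n % m + j) = α j := fun j hj => by
        by_contra hne
        exact hmin j hj ⟨by omega, hne⟩
      refine ⟨i, fun j hj => ?_, ?_⟩
      · simp only [shift]
        rw [hβ1 n j (by omega), hg1 _ (by omega), heq j hj]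
      · simp only [shift]
        rw [hβ1 n i (by omega), hg1 _ (by omega)]
        exact lt_of_le_of_ne (hα.shift_le _ _ heq) h2
    · push Not at P
      refine ⟨m - 1 - n % m, fun j hj => ?_, ?_⟩
      · simp only [shift]
        rw [hβ1 n j (by omega), hg1 _ (by omega), P j (by omega)]
      · have := hα.shift_le (n % m) (m - 1 - n % m) (fun j hj => P j (by omega))
        simp only [shift]
        rw [show n % m + (m - 1 - n % m) = m - 1 by omega] at this
        rw [hβ1 n _ (by omega), show n % m + (m - 1 - n % m) = m - 1 by omega, hg2]
        omega
  · have hk := Nat.mod_lt n (show 0 < m by omega)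
    obtain ⟨j, hj, heq, hlt⟩ := hgood (n % m) hk
    have hag : ∀ i < j, conj M (shift β n) i = α i := fun i hi => by
      simp only [conj, shift]
      rw [hβ1 n i (by omega), hg1 _ (by omega), heq i hi]
    by_cases hj1 : n % m + j < m - 1
    · refine ⟨j, hag, ?_⟩
      simp only [conj, shift]
      rwa [hβ1 n j (by omega), hg1 _ hj1]
    have hj2 : n % m + j = m - 1 := by omega
    have hval : conj M (shift β n) j = M - (α (m - 1) - 1) := by
      simp only [conj, shift]
      rw [hβ1 n j hj, hj2, hg2]
    have hM := hα.le (m - 1)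
    rw [hj2] at hlt
    rcases Nat.lt_or_ge (M - (α (m - 1) - 1)) (α j) with hlt' | hge
    · exact ⟨j, hag, by rwa [hval]⟩
    have hk0 : n % m ≠ 0 := fun h0 => by
      have := heq 0 (by omega)
      rw [h0, add_zero, hα.zero] at this
      have := hα.pos
      omega
    obtain ⟨j', hj', heq', hlt''⟩ := hgood (m - n % m) (by omega)
    have hsh : ∀ i, i ≤ j' → conj M (shift β n) (m - n % m + i) = M - α i := fun i hi => by
      simp only [conj, shift]
      rw [hβ2 n i (by omega), hg1 _ (by omega)]
    refine ⟨m - n % m + j', fun i hi => ?_, ?_⟩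
    · rcases lt_trichotomy i j with h1 | h1 | h1
      · exact hag i h1
      · subst h1; rw [hval]; omega
      · obtain ⟨i', rfl⟩ : ∃ i', i = m - n % m + i' := ⟨i - (m - n % m), by omega⟩
        rw [hsh i' (by omega)]
        have := heq' i' (by omega)
        have := hα.le (m - n % m + i')
        omega
    · rw [hsh j' le_rfl]
      have := hα.le j'
      have := hα.le (m - n % m + j')
      omega
  · simp only [β]
    rw [Nat.mod_eq_of_lt (by omega), hg1 _ (by omega)]

theorem IsLexUnivoque.conj {c : ℕ → ℕ} (hc : IsLexUnivoque M α c) :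
    IsLexUnivoque M α (conj M c) := by
  refine ⟨conj_le M c, fun n hn => hc.2.2 n ?_, fun n hn => ?_⟩
  · simp only [_root_.conj] at hn; omega
  · rw [shift_conj, conj_conj (shift_le hc.1 _)]
    refine hc.2.1 n ?_
    simp only [_root_.conj] at hn; omega

theorem IsLexUnivoque.splice_core {c β : ℕ → ℕ} {p : ℕ} (hβ : IsCore M α β)
    (hc : ∀ i, c i ≤ M)
    (h1 : ∀ n < p, c n < M → LexLt (shift (splice c (p + 1) β) (n + 1)) α)
    (h2 : ∀ n < p, 0 < c n → LexLt (_root_.conj M (shift (splice c (p + 1) β) (n + 1))) α) :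
    IsLexUnivoque M α (splice c (p + 1) β) := by
  have hcn : ∀ n < p, splice c (p + 1) β n = c n := fun n hn => if_pos (by omega)
  have hs : ∀ n, p ≤ n → shift (splice c (p + 1) β) (n + 1) = shift β (n - p) := by
    intro n hn
    rw [← shift_splice c β (p + 1) (n - p)]
    congr 1; omega
  refine ⟨splice_le hc hβ.1, fun n hn => ?_, fun n hn => ?_⟩
  · rcases lt_or_ge n p with hnp | hnp
    · exact h1 n hnp (by rwa [hcn n hnp] at hn)
    · rw [hs n hnp]; exact (hβ.2 _).1
  · rcases lt_or_ge n p with hnp | hnp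
    · exact h2 n hnp (by rwa [hcn n hnp] at hn)
    · rw [hs n hnp]; exact (hβ.2 _).2

/-- The last `N - p` of the first `N + 1` terms of `c` form a prefix of `α`, and the preceding
term is not maximal. -/
def EndsInPrefix (M : ℕ) (α c : ℕ → ℕ) (N p : ℕ) : Prop :=
  c p < M ∧ ∀ i, p + 1 + i ≤ N → c (p + 1 + i) = α i

theorem IsLexUnivoque.exists_near_of_endsInPrefix (hα : IsAdmissible M α) {c : ℕ → ℕ}
    (hc : IsLexUnivoque M α c) {N p : ℕ} (hpN : p ≤ N) (hp : EndsInPrefix M α c N p)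
    (hmin : ∀ n < p, ¬ EndsInPrefix M α c N n ∧ ¬ EndsInPrefix M α (_root_.conj M c) N n) :
    ∃ d, IsLexUnivoque M α d ∧ d ≠ c ∧ ∀ i ≤ N, d i = c i := by
  obtain ⟨l, -, hl⟩ := hc.2.1 p hp.1
  obtain ⟨β, hβ, hag⟩ := hα.exists_core (N + l + 1)
  have hd : ∀ i, splice c (p + 1) β (p + 1 + i) = β i := fun i => by
    rw [splice, if_neg (by omega)]
    congr 1; omega
  have hdc : ∀ i ≤ N, splice c (p + 1) β i = c i := fun i hi => by
    rcases lt_or_ge i (p + 1) with hip | hip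
    · exact if_pos hip
    · obtain ⟨j, rfl⟩ := Nat.exists_eq_add_of_le hip
      rw [hd, hag j (by omega), hp.2 j hi]
  refine ⟨splice c (p + 1) β, IsLexUnivoque.splice_core hβ hc.1 (fun n hn hcn => ?_)
    (fun n hn hcn => ?_), fun heq => ?_, hdc⟩
  · obtain ⟨i, hi, hlt⟩ := hc.2.1 n hcn
    have hiN : n + 1 + i ≤ N := by
      by_contra! hgt
      exact (hmin n hn).1 ⟨hcn, fun j hj => hi j (by omega)⟩
    simp only [shift] at hi hlt
    refine ⟨i, fun j hj => ?_, ?_⟩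
    · rw [shift, hdc _ (by omega), hi j hj]
    · rwa [shift, hdc _ (by omega)]
  · obtain ⟨i, hi, hlt⟩ := hc.2.2 n hcn
    have hiN : n + 1 + i ≤ N := by
      by_contra! hgt
      refine (hmin n hn).2 ⟨?_, fun j hj => hi j (by omega)⟩
      have := hc.1 n
      simp only [_root_.conj]; omega
    simp only [shift, _root_.conj] at hi hlt
    refine ⟨i, fun j hj => ?_, ?_⟩
    · rw [_root_.conj, shift, hdc _ (by omega), hi j hj]
    · rwa [_root_.conj, shift, hdc _ (by omega)]
  · have := congrFun heq (p + 1 + l)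
    rw [hd, hag l (by omega)] at this
    simp only [shift] at hl
    omega

theorem IsLexUnivoque.exists_near (hα : IsAdmissible M α) {c : ℕ → ℕ}
    (hc : IsLexUnivoque M α c) (N : ℕ) :
    ∃ d, IsLexUnivoque M α d ∧ d ≠ c ∧ ∀ i ≤ N, d i = c i := by
  have hpos := hα.pos
  have hlast : EndsInPrefix M α c N N ∨ EndsInPrefix M α (_root_.conj M c) N N := by
    by_cases hN : c N < M
    · exact Or.inl ⟨hN, fun i hi => by omega⟩
    · refine Or.inr ⟨?_, fun i hi => by omega⟩
      simp only [_root_.conj]; omega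
  have hex : ∃ p, EndsInPrefix M α c N p ∨ EndsInPrefix M α (_root_.conj M c) N p := ⟨N, hlast⟩
  have hle : Nat.find hex ≤ N := Nat.find_min' hex hlast
  have hmin : ∀ n < Nat.find hex, _ := fun n hn => not_or.1 (Nat.find_min hex hn)
  rcases Nat.find_spec hex with hp | hp
  · exact hc.exists_near_of_endsInPrefix hα hle hp hmin
  · obtain ⟨d, hd, hne, hag⟩ := hc.conj.exists_near_of_endsInPrefix hα hle hp (fun n hn => by
      rw [conj_conj hc.1]; exact (hmin n hn).symm)
    refine ⟨_root_.conj M d, hd.conj, fun heq => hne ?_, fun i hi => ?_⟩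
    · rw [← heq, conj_conj hd.1]
    · have := hc.1 i
      simp only [_root_.conj] at hag ⊢
      rw [hag i hi]; omega

end Combinatorics

/-- The orbit of `1` under the quasi-greedy map `z ↦ q z - (⌈q z⌉ - 1)`. -/
def qgState (q : ℝ) : ℕ → ℝ
  | 0 => 1
  | n + 1 => q * qgState q n - (⌈q * qgState q n⌉₊ - 1 : ℕ)

/-- The digits of the quasi-greedy expansion of `1` in base `q`. -/
def qgDigit (q : ℝ) (n : ℕ) : ℕ := ⌈q * qgState q n⌉₊ - 1

section QuasiGreedy

variable {q : ℝ} {M : ℕ}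

theorem qgState_succ (q : ℝ) (n : ℕ) :
    qgState q (n + 1) = q * qgState q n - qgDigit q n := rfl

theorem ceil_sub_one_spec {x : ℝ} (hx : 0 < x) :
    0 < x - (⌈x⌉₊ - 1 : ℕ) ∧ x - (⌈x⌉₊ - 1 : ℕ) ≤ 1 := by
  have h1 : 1 ≤ ⌈x⌉₊ := Nat.one_le_ceil_iff.2 hx
  have h2 := Nat.le_ceil x
  have h3 := Nat.ceil_lt_add_one hx.le
  rw [Nat.cast_sub h1]
  push_cast
  constructor <;> linarith

theorem qgState_mem (h : NonIntBase q M) (n : ℕ) : 0 < qgState q n ∧ qgState q n ≤ 1 := by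
  induction n with
  | zero => simp [qgState]
  | succ n ih => exact ceil_sub_one_spec (mul_pos (by linarith [h.one_lt]) ih.1)

theorem qgDigit_eq (h : NonIntBase q M) {n d : ℕ} (h0 : 0 < q * qgState q n - d)
    (h1 : q * qgState q n - d ≤ 1) : d = qgDigit q n := by
  have h2 := qgState_mem h (n + 1)
  rw [qgState_succ] at h2
  have h3 : d < qgDigit q n + 1 := by
    have : (d : ℝ) < qgDigit q n + 1 := by linarith
    exact_mod_cast this
  have h4 : qgDigit q n < d + 1 := by
    have : (qgDigit q n : ℝ) < d + 1 := by linarith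
    exact_mod_cast this
  omega

theorem qgDigit_zero (h : NonIntBase q M) : qgDigit q 0 = M := by
  refine (qgDigit_eq h ?_ ?_).symm <;> simp only [qgState] <;> linarith [h.lt, h.lt_succ]

theorem qgDigit_mono (h : NonIntBase q M) {m n : ℕ} (hmn : qgState q m ≤ qgState q n) :
    qgDigit q m ≤ qgDigit q n := by
  have := mul_le_mul_of_nonneg_left hmn (show 0 ≤ q by linarith [h.one_lt])
  exact Nat.sub_le_sub_right (Nat.ceil_mono this) 1

theorem qgDigit_le (h : NonIntBase q M) (n : ℕ) : qgDigit q n ≤ M := by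
  rw [← qgDigit_zero h]
  exact qgDigit_mono h (qgState_mem h n).2

theorem val_shift_qgDigit (h : NonIntBase q M) (n : ℕ) :
    val q (shift (qgDigit q) n) = qgState q n :=
  val_shift_of_orbit h.one_lt (B := 1)
    (fun n => by rw [abs_of_pos (qgState_mem h n).1]; exact (qgState_mem h n).2)
    (qgState_succ q) n

theorem val_qgDigit (h : NonIntBase q M) : val q (qgDigit q) = 1 := by
  simpa [qgState] using val_shift_qgDigit h 0

theorem qgDigit_shift_le (h : NonIntBase q M) (k n : ℕ)
    (hag : ∀ i < n, qgDigit q (k + i) = qgDigit q i) : qgDigit q (k + n) ≤ qgDigit q n := by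
  refine qgDigit_mono h ?_
  induction n with
  | zero => exact (qgState_mem h k).2
  | succ n ih =>
    have := ih (fun i hi => hag i (by omega))
    rw [← add_assoc, qgState_succ, qgState_succ, hag n (by omega)]
    have := mul_le_mul_of_nonneg_left this (show 0 ≤ q by linarith [h.one_lt])
    linarith

theorem lexLt_qgDigit_of_val_lt_one (h : NonIntBase q M) {c : ℕ → ℕ} (hc : ∀ i, c i ≤ M)
    (hv : val q c < 1) : LexLt c (qgDigit q) := by
  have hq0 : 0 < q := by linarith [h.one_lt]
  by_contra hlex
  have heq : c = qgDigit q := by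
    funext n
    induction n using Nat.strong_induction_on with
    | _ n ih =>
      have h1 := val_sub_val h hc (qgDigit_le h) n ih
      rw [val_qgDigit h, val_shift_qgDigit h, eq_div_iff (by positivity)] at h1
      have h2 : val q (shift c n) < qgState q n := by
        have := mul_neg_of_neg_of_pos (show val q c - 1 < 0 by linarith) (pow_pos hq0 n)
        linarith
      have h3 := mul_lt_mul_of_pos_left h2 hq0
      have h4 := val_shift_succ h hc n
      have h5 := val_nonneg h (shift c (n + 1))
      have h6 := (qgState_mem h (n + 1)).2
      rw [qgState_succ] at h6
      have h7 : c n < qgDigit q n + 1 := by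
        have : (c n : ℝ) < qgDigit q n + 1 := by linarith
        exact_mod_cast this
      by_contra hne
      exact hlex ⟨n, ih, by omega⟩
  rw [heq, val_qgDigit h] at hv
  exact lt_irrefl _ hv

theorem exists_val_shift_sub_one_le (h : NonIntBase q M) {c : ℕ → ℕ} (hc : ∀ i, c i ≤ M) {n : ℕ}
    (hlex : LexLt (shift c n) (qgDigit q)) :
    ∃ k i, c k < M ∧
      val q (shift c n) - 1 < (val q (shift c (k + 1)) - 1) / q ^ (i + 1) := by
  have hq0 : 0 < q := by linarith [h.one_lt]
  obtain ⟨i, hi, hlt⟩ := hlex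
  refine ⟨n + i, i, hlt.trans_le (qgDigit_le h i), ?_⟩
  have h1 := val_sub_val h (shift_le hc n) (qgDigit_le h) i hi
  rw [val_qgDigit h, val_shift_qgDigit h, shift_shift] at h1
  rw [h1, pow_succ', ← div_div]
  refine div_lt_div_of_pos_right ?_ (pow_pos hq0 i)
  rw [lt_div_iff₀ hq0]
  have h2 := val_shift_succ h hc (n + i)
  have h3 := qgState_succ q i
  have h4 := (qgState_mem h (i + 1)).1
  have h5 : (c (n + i) : ℝ) + 1 ≤ qgDigit q i := by
    have : c (n + i) + 1 ≤ qgDigit q i := hlt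
    exact_mod_cast this
  linarith

theorem val_shift_lt_one_of_lexLt (h : NonIntBase q M) {c : ℕ → ℕ} (hc : ∀ i, c i ≤ M)
    (hlex : ∀ n, c n < M → LexLt (shift c (n + 1)) (qgDigit q)) {n : ℕ} (hn : c n < M) :
    val q (shift c (n + 1)) < 1 := by
  have hq := h.one_lt
  have hq0 : 0 < q := by linarith
  have hB : 0 ≤ (M : ℝ) / (q - 1) := by linarith [h.one_lt_top]
  have key : ∀ N n, c n < M → val q (shift c (n + 1)) - 1 ≤ (M / (q - 1)) * (1 / q) ^ N := by
    intro N
    induction N with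
    | zero =>
      intro n _
      have := val_le h (shift_le hc (n + 1))
      simp only [pow_zero, mul_one]
      linarith
    | succ N ih =>
      intro n hn
      obtain ⟨k, i, hk, hlt⟩ := exists_val_shift_sub_one_le h hc (hlex n hn)
      refine hlt.le.trans ?_
      rw [pow_succ (1 / q) N, ← mul_assoc, mul_one_div]
      have hpos : 0 ≤ (M / (q - 1)) * (1 / q) ^ N := by positivity
      refine (div_le_div_of_nonneg_right (ih k hk) (by positivity)).trans ?_
      refine div_le_div_of_nonneg_left hpos hq0 ?_
      exact le_self_pow₀ hq.le (by omega)
  have hle : ∀ n, c n < M → val q (shift c (n + 1)) - 1 ≤ 0 := by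
    intro n hn
    refine ge_of_tendsto' (f := fun N : ℕ => (M / (q - 1)) * (1 / q) ^ N) (x := Filter.atTop) ?_ (fun N => key N n hn)
    simpa using (tendsto_pow_atTop_nhds_zero_of_lt_one (by positivity)
      ((div_lt_one hq0).2 hq)).const_mul ((M : ℝ) / (q - 1))
  obtain ⟨k, i, hk, hlt⟩ := exists_val_shift_sub_one_le h hc (hlex n hn)
  have := div_nonpos_of_nonpos_of_nonneg (hle k hk) (pow_pos hq0 (i + 1)).le
  linarith

theorem isUnivoque_iff_isLexUnivoque (h : NonIntBase q M) {c : ℕ → ℕ} :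
    IsUnivoque q M c ↔ IsLexUnivoque M (qgDigit q) c := by
  constructor
  · intro hc
    exact ⟨hc.1, fun n hn => lexLt_qgDigit_of_val_lt_one h (shift_le hc.1 _)
      (hc.val_shift_lt_one h hn), fun n hn => lexLt_qgDigit_of_val_lt_one h (conj_le M _)
      (hc.val_conj_shift_lt_one h hn)⟩
  · intro hc
    refine isUnivoque_of_val_lt h hc.1 (fun n hn => val_shift_lt_one_of_lexLt h hc.1 hc.2.1 hn)
      (fun n hn => ?_)
    have := hc.1 n
    exact val_shift_lt_one_of_lexLt h (conj_le M c) hc.conj.2.1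
      (n := n) (by simp only [conj]; omega)

end QuasiGreedy

section UnivoqueBases

open Filter Topology

variable {q : ℝ} {M : ℕ}

/-- The orbit of `1` in a univoque base. -/
theorem IsUnivoque.orbit_mem (h : NonIntBase q M) {c : ℕ → ℕ} (hc : IsUnivoque q M c)
    (h1 : val q c = 1) (n : ℕ) :
    0 ≤ val q (shift c n) ∧ val q (shift c n) ≤ 1 ∧
      (0 < n → M / (q - 1) - 1 < val q (shift c n)) := by
  have hq := h.one_lt
  have htop := h.one_lt_top
  have hc0 : 0 < c 0 := by
    by_contra! h0
    have hlt := hc.val_shift_lt_one h (n := 0) (by have := h.pos; omega)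
    have := val_shift_succ h hc.1 0
    rw [shift_zero, h1, Nat.le_zero.1 h0] at this
    simp at this
    simp at hlt
    linarith
  induction n with
  | zero => simp [h1]
  | succ n ih =>
    have hs := val_shift_succ h hc.1 n
    refine ⟨val_nonneg h _, ?_, fun _ => ?_⟩
    · rcases lt_or_eq_of_le (hc.1 n) with hlt | heq
      · exact (hc.val_shift_lt_one h hlt).le
      · rw [hs, heq]
        have e := h.top_eq
        nlinarith [ih.2.1]
    · rcases Nat.eq_zero_or_pos (c n) with h0 | hpos
      · rw [hs, h0]
        have hn : 0 < n := by
          rcases Nat.eq_zero_or_pos n with rfl | hn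
          · omega
          · exact hn
        have := ih.2.2 hn
        push_cast
        nlinarith [ih.1]
      · have := hc.val_conj_shift_lt_one h hpos
        rw [val_conj h (shift_le hc.1 _)] at this
        linarith

theorem NonIntBase.eventually (h : NonIntBase q M) : ∀ᶠ p in 𝓝 q, NonIntBase p M := by
  filter_upwards [Ioo_mem_nhds h.lt h.lt_succ] with p hp
  exact ⟨h.pos, hp.1, hp.2⟩

theorem NonIntBase.exists_univoque {p : ℝ} (hp : NonIntBase p M) (hU : p ∈ USet) :
    ∃ c, IsUnivoque p M c ∧ val p c = 1 :=
  (existsUnique_expansion_iff hp).1 hU.2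

theorem tendsto_top (h : NonIntBase q M) :
    Tendsto (fun p : ℝ => (M : ℝ) / (p - 1) - 1) (𝓝[USet] q) (𝓝 (M / (q - 1) - 1)) := by
  have hne : q - 1 ≠ 0 := by linarith [h.one_lt]
  have : ContinuousAt (fun p : ℝ => (M : ℝ) / (p - 1) - 1) q := by fun_prop (disch := exact hne)
  exact this.tendsto.mono_left nhdsWithin_le_nhds

/-- As univoque bases approach `q`, the expansions of `1` converge to the quasi-greedy one. -/
theorem tendsto_orbit (h : NonIntBase q M) {γ : ℝ → ℕ → ℕ}
    (hγ : ∀ᶠ p in 𝓝[USet] q, NonIntBase p M ∧ IsUnivoque p M (γ p) ∧ val p (γ p) = 1) (n : ℕ) :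
    Tendsto (fun p => val p (shift (γ p) n)) (𝓝[USet] q) (𝓝 (qgState q n)) ∧
      ∀ᶠ p in 𝓝[USet] q, ∀ i < n, γ p i = qgDigit q i := by
  induction n with
  | zero =>
    refine ⟨?_, by simp⟩
    refine tendsto_const_nhds.congr' ?_
    filter_upwards [hγ] with p hp
    simp [qgState, hp.2.2]
  | succ n ih =>
    have hid : Tendsto (fun p : ℝ => p) (𝓝[USet] q) (𝓝 q) := tendsto_id.mono_left nhdsWithin_le_nhds
    have hw : Tendsto (fun p => p * val p (shift (γ p) n) - qgDigit q n) (𝓝[USet] q)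
        (𝓝 (qgState q (n + 1))) := (hid.mul ih.1).sub_const _
    have hmem := qgState_mem h (n + 1)
    have hδ : 0 < (M : ℝ) / (q - 1) - 1 := by linarith [h.one_lt_top]
    have hdig : ∀ᶠ p in 𝓝[USet] q, γ p n = qgDigit q n := by
      filter_upwards [hγ, hw.eventually_const_lt hmem.1,
        (hw.sub (tendsto_top h)).eventually_lt_const
          (show qgState q (n + 1) - (M / (q - 1) - 1) < 1 by linarith)] with p hp hp0 hp1
      have horb := hp.2.1.orbit_mem hp.1 hp.2.2 (n + 1)
      have hlow := horb.2.2 (by omega)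
      have hup := horb.2.1
      rw [val_shift_succ hp.1 hp.2.1.1] at hlow hup
      have h1 : γ p n < qgDigit q n + 1 := by
        have : (γ p n : ℝ) < qgDigit q n + 1 := by linarith
        exact_mod_cast this
      have h2 : qgDigit q n < γ p n + 1 := by
        have : (qgDigit q n : ℝ) < γ p n + 1 := by linarith
        exact_mod_cast this
      omega
    refine ⟨hw.congr' ?_, ?_⟩
    · filter_upwards [hγ, hdig] with p hp hd
      rw [val_shift_succ hp.1 hp.2.1.1, hd]
    · filter_upwards [ih.2, hdig] with p hp hd i hi
      rcases Nat.lt_succ_iff_lt_or_eq.1 hi with hi | rfl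
      · exact hp i hi
      · exact hd

theorem orbit_le_of_base_le {p : ℝ} (hp : NonIntBase p M) (hpq : p ≤ q) {c : ℕ → ℕ}
    (hc : ∀ i, c i ≤ M) (h1 : val p c = 1) (n : ℕ) (hag : ∀ i < n, c i = qgDigit q i) :
    val p (shift c n) ≤ qgState q n := by
  induction n with
  | zero => simp [h1, qgState]
  | succ n ih =>
    have := ih (fun i hi => hag i (by omega))
    rw [val_shift_succ hp hc, qgState_succ, hag n (by omega)]
    have := mul_le_mul hpq this (val_nonneg hp _) (by linarith [hp.one_lt])
    linarith

theorem lt_orbit_of_base_lt (h : NonIntBase q M) {p : ℝ} (hp : NonIntBase p M) (hqp : q < p)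
    {c : ℕ → ℕ} (hc : ∀ i, c i ≤ M) (h1 : val p c = 1) (n : ℕ)
    (hag : ∀ i < n + 1, c i = qgDigit q i) :
    qgState q (n + 1) < val p (shift c (n + 1)) := by
  have hle : qgState q n ≤ val p (shift c n) := by
    cases n with
    | zero => simp [h1, qgState]
    | succ n => exact (lt_orbit_of_base_lt h hp hqp hc h1 n (fun i hi => hag i (by omega))).le
  rw [val_shift_succ hp hc, qgState_succ, hag n (by omega)]
  have := mul_lt_mul hqp hle (qgState_mem h n).1 (by linarith [hp.one_lt])
  linarith

theorem lt_qgState (h : NonIntBase q M) (hcl : q ∈ closure USet) {k : ℕ} (hk : 0 < k) :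
    M / (q - 1) - 1 < qgState q k := by
  have hne : (𝓝[USet] q).NeBot := mem_closure_iff_nhdsWithin_neBot.1 hcl
  have hδ : 0 < (M : ℝ) / (q - 1) - 1 := by linarith [h.one_lt_top]
  have hex : ∀ p, ∃ c, NonIntBase p M → p ∈ USet → IsUnivoque p M c ∧ val p c = 1 := by
    intro p
    by_cases hp : NonIntBase p M ∧ p ∈ USet
    · obtain ⟨c, hc⟩ := hp.1.exists_univoque hp.2
      exact ⟨c, fun _ _ => hc⟩
    · exact ⟨fun _ => 0, fun h1 h2 => (hp ⟨h1, h2⟩).elim⟩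
  choose γ hγ' using hex
  have hγ : ∀ᶠ p in 𝓝[USet] q, NonIntBase p M ∧ IsUnivoque p M (γ p) ∧ val p (γ p) = 1 := by
    filter_upwards [h.eventually.filter_mono nhdsWithin_le_nhds, self_mem_nhdsWithin] with p h1 h2
    exact ⟨h1, hγ' p h1 h2⟩
  have hge : ∀ n, 0 < n → M / (q - 1) - 1 ≤ qgState q n := by
    intro n hn
    refine le_of_tendsto_of_tendsto (tendsto_top h) (tendsto_orbit h hγ n).1 ?_
    filter_upwards [hγ] with p hp
    exact ((hp.2.1.orbit_mem hp.1 hp.2.2 n).2.2 hn).le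
  refine lt_of_le_of_ne (hge k hk) fun heq => ?_
  have hper : ∀ i, M / (q - 1) - qgState q (k + i) = qgState q i := by
    intro i
    induction i with
    | zero => rw [add_zero, ← heq]; simp [qgState]
    | succ i ih =>
      have hle := qgDigit_le h (k + i)
      have e : q * qgState q i - (M - qgDigit q (k + i) : ℕ) =
          M / (q - 1) - qgState q (k + i + 1) := by
        rw [Nat.cast_sub hle, ← ih, mul_sub, h.top_eq, qgState_succ]; ring
      have hd := qgDigit_eq h (n := i) (d := M - qgDigit q (k + i))
        (by rw [e]; linarith [(qgState_mem h (k + i + 1)).2])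
        (by rw [e]; linarith [hge (k + i + 1) (by omega)])
      rw [← add_assoc, ← e, hd, qgState_succ]
  have h2k : qgState q (k + k) = 1 := by
    have := hper k
    linarith
  obtain ⟨p, hp, hag⟩ := (hγ.and (tendsto_orbit h hγ (k + k)).2).exists
  have horb := hp.2.1.orbit_mem hp.1 hp.2.2
  rcases le_or_gt p q with hpq | hqp
  · have h1 := orbit_le_of_base_le hp.1 hpq hp.2.1.1 hp.2.2 k (fun i hi => hag i (by omega))
    have h2 := (horb k).2.2 hk
    have h3 : (M : ℝ) / (q - 1) ≤ M / (p - 1) :=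
      div_le_div_of_nonneg_left (by positivity) (by linarith [hp.1.one_lt]) (by linarith)
    linarith
  · obtain ⟨l, hl⟩ : ∃ l, k + k = l + 1 := ⟨k + k - 1, by omega⟩
    rw [hl] at hag h2k
    have h1 := lt_orbit_of_base_lt h hp.1 hqp hp.2.1.1 hp.2.2 l hag
    have h2 := (horb (l + 1)).2.1
    linarith

theorem isAdmissible_qgDigit (h : NonIntBase q M) (hcl : q ∈ closure USet) :
    IsAdmissible M (qgDigit q) where
  pos := h.pos
  le := qgDigit_le h
  zero := qgDigit_zero h
  shift_le := qgDigit_shift_le h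
  conj_lt := by
    intro k
    rcases Nat.eq_zero_or_pos k with rfl | hk
    · refine ⟨0, by simp, ?_⟩
      simpa [conj, qgDigit_zero h] using h.pos
    · refine lexLt_qgDigit_of_val_lt_one h (conj_le M _) ?_
      rw [val_conj h (shift_le (qgDigit_le h) k), val_shift_qgDigit h]
      linarith [lt_qgState h hcl hk]

end UnivoqueBases

section Topology

variable {q : ℝ} {M : ℕ}

theorem mem_Uq_iff (h : NonIntBase q M) {x : ℝ} :
    x ∈ Uq q ↔ ∃ c, IsUnivoque q M c ∧ val q c = x :=
  existsUnique_expansion_iff h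

theorem exists_agree_dist_lt (h : NonIntBase q M) {ε : ℝ} (hε : 0 < ε) :
    ∃ n : ℕ, ∀ c d : ℕ → ℕ, (∀ i, c i ≤ M) → (∀ i, d i ≤ M) → (∀ i < n, c i = d i) →
      dist (val q c) (val q d) < ε := by
  have hq0 : 0 < q := by linarith [h.one_lt]
  obtain ⟨n, hn⟩ := pow_unbounded_of_one_lt ((M / (q - 1)) / ε) h.one_lt
  refine ⟨n, fun c d hc hd hag => (abs_val_sub_val_le h hc hd n hag).trans_lt ?_⟩
  rw [div_lt_comm₀ (by positivity) hε]
  exact hn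

theorem val_splice_zero_qgDigit (h : NonIntBase q M) :
    val q (splice (fun _ => 0) 1 (qgDigit q)) = q⁻¹ := by
  have h1 := val_shift_succ h
    (splice_le (n := 1) (c := fun _ => 0) (fun _ => Nat.zero_le M) (qgDigit_le h)) 0
  rw [zero_add, shift_splice_self, val_qgDigit h, shift_zero] at h1
  refine eq_inv_of_mul_eq_one_right ?_
  simpa [splice] using h1.symm

theorem inv_mem_closure_Uq (h : NonIntBase q M) (hcl : q ∈ closure USet) :
    q⁻¹ ∈ closure (Uq q) := by
  have hα := isAdmissible_qgDigit h hcl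
  rw [Metric.mem_closure_iff]
  intro ε hε
  obtain ⟨n, hn⟩ := exists_agree_dist_lt h hε
  obtain ⟨β, hβ, hag⟩ := hα.exists_core n
  have hz : ∀ i : ℕ, (fun _ : ℕ => 0) i ≤ M := fun _ => Nat.zero_le M
  have hu : IsUnivoque q M (splice (fun _ => 0) 1 β) :=
    (isUnivoque_iff_isLexUnivoque h).2
      (IsLexUnivoque.splice_core (p := 0) hβ hz (by simp) (by simp))
  refine ⟨_, (mem_Uq_iff h).2 ⟨_, hu, rfl⟩, ?_⟩
  rw [← val_splice_zero_qgDigit h]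
  refine hn _ _ (splice_le hz hα.le) hu.1 fun i hi => ?_
  simp only [splice]
  split_ifs
  · rfl
  · exact (hag _ (by omega)).symm

theorem not_mem_Uq_of_two_digits (h : NonIntBase q M) {c : ℕ → ℕ} (hc : ∀ i, c i ≤ M) {n : ℕ}
    (hn : c n < M) (hv : 1 ≤ val q (shift c (n + 1))) : val q c ∉ Uq q := by
  intro hx
  obtain ⟨d, hd, hdv⟩ := (mem_Uq_iff h).1 hx
  obtain rfl := hd.2 c hc hdv.symm
  exact (hd.val_shift_lt_one h hn).not_ge hv

theorem inv_not_mem_Uq (h : NonIntBase q M) : q⁻¹ ∉ Uq q := by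
  rw [← val_splice_zero_qgDigit h]
  refine not_mem_Uq_of_two_digits h (splice_le (fun _ => Nat.zero_le M) (qgDigit_le h)) (n := 0)
    (by simpa [splice] using h.pos) ?_
  rw [zero_add, shift_splice_self, val_qgDigit h]

theorem mem_closure_Uq_diff (h : NonIntBase q M) (hcl : q ∈ closure USet) {x : ℝ}
    (hx : x ∈ Uq q) : x ∈ closure (Uq q \ {x}) := by
  obtain ⟨c, hc, rfl⟩ := (mem_Uq_iff h).1 hx
  rw [Metric.mem_closure_iff]
  intro ε hε
  obtain ⟨n, hn⟩ := exists_agree_dist_lt h hε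
  obtain ⟨d, hd, hne, hag⟩ :=
    ((isUnivoque_iff_isLexUnivoque h).1 hc).exists_near (isAdmissible_qgDigit h hcl) n
  have hd' := (isUnivoque_iff_isLexUnivoque h).2 hd
  refine ⟨val q d, ⟨(mem_Uq_iff h).2 ⟨d, hd', rfl⟩, fun heq => hne (hc.2 d hd.1 heq)⟩, ?_⟩
  exact hn c d hc.1 hd.1 fun i hi => (hag i hi.le).symm

theorem interior_closure_Uq (h : NonIntBase q M) : interior (closure (Uq q)) = ∅ := by
  have hq0 : 0 < q := by linarith [h.one_lt]
  have htop := h.one_lt_top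
  rw [Set.eq_empty_iff_forall_notMem]
  intro x₀ hx₀
  obtain ⟨x, hxO, hxU⟩ := mem_closure_iff.1 (interior_subset hx₀) _ isOpen_interior hx₀
  obtain ⟨c, hc, rfl⟩ := (mem_Uq_iff h).1 hxU
  obtain ⟨ε, hε, hball⟩ := Metric.isOpen_iff.1 isOpen_interior _ hxO
  obtain ⟨n, hn⟩ := exists_agree_dist_lt h hε
  obtain ⟨b, hb, hbM⟩ : ∃ b : ℕ → ℕ, (∀ i, b i ≤ M) ∧ (∀ i < n, c i = b i) ∧ b n < M := by
    refine ⟨fun i => if i < n then c i else 0, fun i => ?_, fun i hi => by simp [hi], ?_⟩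
    · dsimp only; split_ifs
      · exact hc.1 i
      · exact Nat.zero_le M
    · simpa using h.pos
  have hz : ∀ i : ℕ, (fun _ : ℕ => 0) i ≤ M := fun _ => Nat.zero_le M
  set w := val q (splice b (n + 1) fun _ => 0) with hw
  have hpt : ∀ s, 1 < s → s < M / (q - 1) →
      w + s / q ^ (n + 1) ∉ Uq q ∧ w + s / q ^ (n + 1) ∈ Metric.ball (val q c) ε := by
    intro s hs1 hs2
    obtain ⟨e, he, hev⟩ := exists_val_eq h (by linarith) hs2.le
    have hd := splice_le hb (n := n + 1) he
    have hval : w + s / q ^ (n + 1) = val q (splice b (n + 1) e) := by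
      have h1 := val_sub_val h hd (splice_le hb (n := n + 1) hz) (n + 1)
        (fun i hi => by simp [splice, hi])
      have h2 : val q (fun _ => 0) = 0 := by simp [val]
      rw [shift_splice_self, shift_splice_self, hev, h2, sub_zero] at h1
      linarith
    rw [hval]
    constructor
    · refine not_mem_Uq_of_two_digits h hd (n := n) ?_ ?_
      · simpa [splice] using hbM.2
      · rw [shift_splice_self, hev]; exact hs1.le
    · rw [Metric.mem_ball, dist_comm]
      refine hn _ _ hc.1 hd fun i hi => ?_
      rw [hbM.1 i hi, splice, if_pos (by omega)]
  obtain ⟨s, hs1, hs2⟩ := exists_between htop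
  have hcl : w + s / q ^ (n + 1) ∈ closure (Uq q) :=
    interior_subset (hball (hpt s hs1 hs2).2)
  have hqn : 0 < q ^ (n + 1) := by positivity
  obtain ⟨y, hy, hyU⟩ := mem_closure_iff.1 hcl
    (Set.Ioo (w + 1 / q ^ (n + 1)) (w + (M / (q - 1)) / q ^ (n + 1))) isOpen_Ioo
    ⟨by gcongr, by gcongr⟩
  refine (hpt ((y - w) * q ^ (n + 1)) ?_ ?_).1 ?_
  · rw [← div_lt_iff₀ hqn]; linarith [hy.1]
  · rw [← lt_div_iff₀ hqn]; linarith [hy.2]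
  · rwa [mul_div_cancel_right₀ _ hqn.ne', add_sub_cancel]

end Topology

theorem exists_nonIntBase {q : ℝ} (hq : 1 < q) (hni : ∀ n : ℤ, (n : ℝ) ≠ q) :
    ∃ M, NonIntBase q M := by
  refine ⟨⌊q⌋₊, Nat.floor_pos.2 hq.le, ?_, Nat.lt_floor_add_one q⟩
  refine lt_of_le_of_ne (Nat.floor_le (by linarith)) ?_
  exact_mod_cast hni ⌊q⌋₊

/-- If `q > 1` is a non-integer in the closure of `U`, then `U_q` is
not a Cantor set but its closure is. -/
theorem closure_Uq_cantor (q : ℝ) (hq : 1 < q) (h : q ∈ closure USet)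
    (hni : ∀ n : ℤ, (n : ℝ) ≠ q) :
    ¬ IsCantorSet (Uq q) ∧ IsCantorSet (closure (Uq q)) := by
  obtain ⟨M, hM⟩ := exists_nonIntBase hq hni
  have hmem := inv_mem_closure_Uq hM h
  refine ⟨fun hC => inv_not_mem_Uq hM (hC.2.1.closure_subset hmem), ⟨_, hmem⟩, isClosed_closure,
    interior_closure_Uq hM, fun x hx => ?_⟩
  by_cases hxU : x ∈ Uq q
  · exact closure_mono (Set.sdiff_subset_sdiff_left subset_closure) (mem_closure_Uq_diff hM h hxU)
  · have hsub : Uq q ⊆ closure (Uq q) \ {x} := fun y hy =>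
      ⟨subset_closure hy, fun hyx => hxU (hyx ▸ hy)⟩
    exact closure_mono hsub hx
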